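/- arXiv:2402.17530 — 4 statements merged into one kernel-verified Lean document; each statement's English description precedes it below -/
import Mathlib

section
/- Let g be an invertible symmetric real 4×4 matrix with inverse h, and let v ∈ ℝ⁴ be a covector with h(v,v) ≠ 0. Then a symmetric 4×4 matrix A lies in the range of the operator 𝒫_v acting on symmetric 4×4 matrices if and only if Pol(A, v) = 0; i.e., there exists a symmetric 4×4 matrix S with 𝒫_v(S) = A if and only if Pol(A,v)_α = 0 for every α. -/
open BigOperators

/-- The polarization covector `Pol(S,v)_α = h^{μν} S_{αμ} v_ν − (1/2)(tr_g S) v_α`. -/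
noncomputable def Pol (h S : Fin 4 → Fin 4 → ℝ) (v : Fin 4 → ℝ) : Fin 4 → ℝ :=
  fun α => (∑ μ, ∑ ν, h μ ν * S α μ * v ν)
    - (1 / 2) * (∑ μ, ∑ ν, h μ ν * S μ ν) * v α

/-- The operator `𝒫_v(S)_{αβ} = −h(v,v) S_{αβ} + v_α Pol(S,v)_β + v_β Pol(S,v)_α`. -/
noncomputable def Pv (h : Fin 4 → Fin 4 → ℝ) (v : Fin 4 → ℝ) (S : Fin 4 → Fin 4 → ℝ) :
    Fin 4 → Fin 4 → ℝ :=
  fun α β => -(∑ μ, ∑ ν, h μ ν * v μ * v ν) * S α β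
    + v α * Pol h S v β + v β * Pol h S v α

/-- A left inverse of a symmetric matrix is symmetric. -/
theorem symm_of_left_inverse {n : Type*} [Fintype n] [DecidableEq n] {g h : n → n → ℝ}
    (hg : ∀ α β, g α β = g β α)
    (hinv : ∀ α β, (∑ σ, h α σ * g σ β) = if α = β then (1 : ℝ) else 0) (α β : n) :
    h α β = h β α := by
  have hmul : Matrix.of h * Matrix.of g = 1 := by
    ext i j
    simpa [Matrix.mul_apply, Matrix.one_apply] using hinv i j
  have hsymm : (Matrix.of g).IsSymm := Matrix.IsSymm.ext fun i j => hg j i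
  have hh := hsymm.inv
  rw [Matrix.inv_eq_left_inv hmul] at hh
  exact hh.apply β α

theorem Pol_const_mul (h S : Fin 4 → Fin 4 → ℝ) (v : Fin 4 → ℝ) (c : ℝ) (α : Fin 4) :
    Pol h (fun α β => c * S α β) v α = c * Pol h S v α := by
  simp only [Pol, Fin.sum_univ_four]
  ring

theorem Pol_add (h S T : Fin 4 → Fin 4 → ℝ) (v : Fin 4 → ℝ) (α : Fin 4) :
    Pol h (fun α β => S α β + T α β) v α = Pol h S v α + Pol h T v α := by
  simp only [Pol, Fin.sum_univ_four]
  ring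

/-- The polarization of the symmetrized product of `v` and `w` is `h(v,v) w`. -/
theorem Pol_symm_mul {h : Fin 4 → Fin 4 → ℝ} (hh : ∀ μ ν, h μ ν = h ν μ)
    (v w : Fin 4 → ℝ) (α : Fin 4) :
    Pol h (fun α β => v α * w β + v β * w α) v α
      = (∑ μ, ∑ ν, h μ ν * v μ * v ν) * w α := by
  simp only [Pol, Fin.sum_univ_four, hh 1 0, hh 2 0, hh 3 0, hh 2 1, hh 3 1, hh 3 2]
  ring

theorem Pol_Pv {h : Fin 4 → Fin 4 → ℝ} (hh : ∀ μ ν, h μ ν = h ν μ)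
    (v : Fin 4 → ℝ) (S : Fin 4 → Fin 4 → ℝ) (α : Fin 4) :
    Pol h (Pv h v S) v α = 0 := by
  have hPv : Pv h v S = fun α β => -(∑ μ, ∑ ν, h μ ν * v μ * v ν) * S α β
      + (v α * Pol h S v β + v β * Pol h S v α) := by
    ext α β
    rw [Pv, add_assoc]
  rw [hPv, Pol_add, Pol_const_mul, Pol_symm_mul hh]
  ring

/-- a symmetric matrix `A` lies in the range of `𝒫_v` on symmetric matrices
iff `Pol(A,v) = 0`, provided `h(v,v) ≠ 0`. -/
theorem statement1
    (g h : Fin 4 → Fin 4 → ℝ)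
    (hg_symm : ∀ α β, g α β = g β α)
    (h_inv₁ : ∀ α β, (∑ σ, g α σ * h σ β) = if α = β then (1 : ℝ) else 0)
    (h_inv₂ : ∀ α β, (∑ σ, h α σ * g σ β) = if α = β then (1 : ℝ) else 0)
    (v : Fin 4 → ℝ)
    (hv : (∑ μ, ∑ ν, h μ ν * v μ * v ν) ≠ 0)
    (A : Fin 4 → Fin 4 → ℝ)
    (hA_symm : ∀ α β, A α β = A β α) :
    (∃ S : Fin 4 → Fin 4 → ℝ, (∀ α β, S α β = S β α) ∧ Pv h v S = A)
      ↔ (∀ α, Pol h A v α = 0) := by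
  constructor
  · rintro ⟨S, -, rfl⟩
    exact Pol_Pv (symm_of_left_inverse hg_symm h_inv₂) v S
  · intro hA
    set N := ∑ μ, ∑ ν, h μ ν * v μ * v ν with hN
    refine ⟨fun α β => -N⁻¹ * A α β, fun α β => congrArg (-N⁻¹ * ·) (hA_symm α β), ?_⟩
    ext α β
    rw [Pv, Pol_const_mul, Pol_const_mul, hA, hA, ← hN]
    field_simp
    ring
end

section
/- Let g be a positive definite symmetric real 3×3 matrix with inverse h, and let N ∈ ℝ³ be a g-unit vector. Then the operator P̄¹_N on symmetric 3×3 matrices is idempotent: P̄¹_N(P̄¹_N(S)) = P̄¹_N(S) for every symmetric S. Moreover, a symmetric 3×3 matrix A lies in the range of P̄¹_N (i.e., there exists a symmetric S with P̄¹_N(S) = A) if and only if tr A = A_{NN}. -/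
open BigOperators

/-- `tr S := h^{ij} S_{ij}`. -/
noncomputable def trH (h S : Fin 3 → Fin 3 → ℝ) : ℝ := ∑ i, ∑ j, h i j * S i j

/-- `S_{NN} := N^i N^j S_{ij}`. -/
noncomputable def quadN (N : Fin 3 → ℝ) (S : Fin 3 → Fin 3 → ℝ) : ℝ :=
  ∑ i, ∑ j, N i * N j * S i j

/-- The operator `P̄¹_N(S)_{ij} := S_{ij} − (1/2)(tr S − S_{NN}) g_{ij}`. -/
noncomputable def P1 (g h : Fin 3 → Fin 3 → ℝ) (N : Fin 3 → ℝ) (S : Fin 3 → Fin 3 → ℝ) :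
    Fin 3 → Fin 3 → ℝ :=
  fun i j => S i j - (1 / 2) * (trH h S - quadN N S) * g i j

theorem trH_P1 (g h : Fin 3 → Fin 3 → ℝ) (N : Fin 3 → ℝ) (S : Fin 3 → Fin 3 → ℝ) :
    trH h (P1 g h N S) = trH h S - (1 / 2) * (trH h S - quadN N S) * trH h g := by
  unfold P1
  generalize (1 / 2) * (trH h S - quadN N S) = c
  simp only [trH, mul_sub, Finset.sum_sub_distrib, Finset.mul_sum, mul_left_comm _ c]

theorem quadN_P1 (g h : Fin 3 → Fin 3 → ℝ) (N : Fin 3 → ℝ) (S : Fin 3 → Fin 3 → ℝ) :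
    quadN N (P1 g h N S) = quadN N S - (1 / 2) * (trH h S - quadN N S) * quadN N g := by
  unfold P1
  generalize (1 / 2) * (trH h S - quadN N S) = c
  simp only [quadN, mul_sub, Finset.sum_sub_distrib, Finset.mul_sum, mul_left_comm _ c]

theorem trH_metric {g h : Fin 3 → Fin 3 → ℝ} (hg_symm : ∀ i j, g i j = g j i)
    (h_inv : ∀ i j, (∑ k, h i k * g k j) = if i = j then (1 : ℝ) else 0) : trH h g = 3 := by
  have key : ∀ i, ∑ j, h i j * g i j = 1 := fun i => by
    simpa only [hg_symm i, if_true] using h_inv i i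
  simp [trH, key]

/-- A matrix with `tr S = S_{NN}` is fixed by `P̄¹_N`. -/
theorem P1_eq_self {g h S : Fin 3 → Fin 3 → ℝ} {N : Fin 3 → ℝ}
    (hS : trH h S = quadN N S) : P1 g h N S = S := by
  funext i j
  simp [P1, hS]

/-- If `tr g = 3` and `g_{NN} = 1`, every value of `P̄¹_N` has `tr = (·)_{NN}`. -/
theorem trH_P1_eq_quadN_P1 {g h : Fin 3 → Fin 3 → ℝ} {N : Fin 3 → ℝ}
    (htr : trH h g = 3) (hquad : quadN N g = 1) (S : Fin 3 → Fin 3 → ℝ) :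
    trH h (P1 g h N S) = quadN N (P1 g h N S) := by
  rw [trH_P1, quadN_P1, htr, hquad]
  ring

/-- `P̄¹_N` is idempotent on symmetric matrices, and a symmetric `A` lies in its
range iff `tr A = A_{NN}`. -/
theorem statement8
    (g h : Fin 3 → Fin 3 → ℝ)
    (hg_symm : ∀ i j, g i j = g j i)
    (hg_pos : ∀ ξ : Fin 3 → ℝ, ξ ≠ 0 → 0 < ∑ i, ∑ j, g i j * ξ i * ξ j)
    (h_inv₁ : ∀ i j, (∑ k, g i k * h k j) = if i = j then (1 : ℝ) else 0)
    (h_inv₂ : ∀ i j, (∑ k, h i k * g k j) = if i = j then (1 : ℝ) else 0)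
    (N : Fin 3 → ℝ)
    (hN : (∑ i, ∑ j, g i j * N i * N j) = 1) :
    (∀ S : Fin 3 → Fin 3 → ℝ, (∀ i j, S i j = S j i) →
        P1 g h N (P1 g h N S) = P1 g h N S)
    ∧ (∀ A : Fin 3 → Fin 3 → ℝ, (∀ i j, A i j = A j i) →
        ((∃ S : Fin 3 → Fin 3 → ℝ, (∀ i j, S i j = S j i) ∧ P1 g h N S = A)
          ↔ trH h A = quadN N A)) := by
  have htr : trH h g = 3 := trH_metric hg_symm h_inv₂
  have hquad : quadN N g = 1 := by
    rw [← hN]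
    exact Finset.sum_congr rfl fun i _ => Finset.sum_congr rfl fun j _ => by ring
  refine ⟨fun S _ => P1_eq_self (trH_P1_eq_quadN_P1 htr hquad S), fun A hA => ⟨?_, fun hAN => ?_⟩⟩
  · rintro ⟨S, _, rfl⟩
    exact trH_P1_eq_quadN_P1 htr hquad S
  · exact ⟨A, hA, P1_eq_self hAN⟩
end

section
/- Let g be a positive definite symmetric real 3×3 matrix with inverse h, let ω ∈ ℝ³ be a nonzero covector with |ω| := √(h^{ij} ω_i ω_j), let F ∈ ℝ, and let F̄ be a symmetric 3×3 matrix with h^{ik} h^{jl} F̄_{ij} F̄_{kl} = 8 F². Let 𝐠 be the block Lorentzian 4×4 matrix built from g with inverse 𝐡, and let ℓ be the 4-covector with ℓ₀ := |ω| and ℓ_i := ω_i (so 𝐡(ℓ,ℓ) = 0). Define the symmetric 4×4 matrix F⁽²²⁾ by F⁽²²⁾_{ij} := (3/4) F² g_{ij}, F⁽²²⁾_{00} := 0, F⁽²²⁾_{0i} = F⁽²²⁾_{i0} := (3/8) F² ω_i / |ω|. Then the covector V := Pol_𝐠(F⁽²²⁾, ℓ) + (3/32)(h^{ik} h^{jl}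 F̄_{ij} F̄_{kl}) ℓ vanishes: for every α ∈ {0,1,2,3}, 𝐡^{μν} F⁽²²⁾_{αμ} ℓ_ν − (1/2)(𝐡^{μν} F⁽²²⁾_{μν}) ℓ_α + (3/4) F² ℓ_α = 0. (This is the polarization condition V^{(2,2)} = 0 for the second-harmonic corrector on the initial hypersurface.) -/
open BigOperators

/-- The block 4×4 matrix with `00`-entry `a`, `0i`- and `i0`-entries `b i`, and
spatial block `m`. -/
noncomputable def blk (a : ℝ) (b : Fin 3 → ℝ) (m : Fin 3 → Fin 3 → ℝ) :
    Fin 4 → Fin 4 → ℝ :=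
  fun μ ν =>
    if hμ : μ = 0 then
      (if hν : ν = 0 then a else b (ν.pred hν))
    else
      (if hν : ν = 0 then b (μ.pred hμ) else m (μ.pred hμ) (ν.pred hν))

/-- The 4-covector with time component `a` and spatial components `ω`. -/
noncomputable def cov4 (a : ℝ) (ω : Fin 3 → ℝ) : Fin 4 → ℝ :=
  fun μ => if hμ : μ = 0 then a else ω (μ.pred hμ)

/-- `|ω| := √(h^{ij} ω_i ω_j)`. -/
noncomputable def nrm3 (h : Fin 3 → Fin 3 → ℝ) (ω : Fin 3 → ℝ) : ℝ :=
  Real.sqrt (∑ i, ∑ j, h i j * ω i * ω j)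

/-- Contracting `g` with the vector obtained from `ω` by raising its index gives back `ω`. -/
theorem sum_mul_sum_mul_of_inverse {g h : Fin 3 → Fin 3 → ℝ}
    (h_inv : ∀ i j, (∑ k, g i k * h k j) = if i = j then (1 : ℝ) else 0)
    (ω : Fin 3 → ℝ) (i : Fin 3) :
    ∑ j, g i j * ∑ k, h j k * ω k = ω i := by
  simp_rw [Finset.mul_sum, ← mul_assoc]
  rw [Finset.sum_comm]
  simp_rw [← Finset.sum_mul, h_inv]
  simp

/-- The inverse of a positive definite matrix is positive on nonzero covectors. -/
theorem sum_inverse_mul_mul_pos {g h : Fin 3 → Fin 3 → ℝ}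
    (hg_pos : ∀ ξ : Fin 3 → ℝ, ξ ≠ 0 → 0 < ∑ i, ∑ j, g i j * ξ i * ξ j)
    (h_inv : ∀ i j, (∑ k, g i k * h k j) = if i = j then (1 : ℝ) else 0)
    {ω : Fin 3 → ℝ} (hω : ω ≠ 0) :
    0 < ∑ i, ∑ j, h i j * ω i * ω j := by
  have lower := sum_mul_sum_mul_of_inverse h_inv ω
  have raised_ne : (fun i => ∑ j, h i j * ω j) ≠ 0 := by
    intro h0
    apply hω
    funext i
    rw [← lower i]
    simp [fun j => congrFun h0 j]
  refine (hg_pos _ raised_ne).trans_eq (Finset.sum_congr rfl fun i _ => ?_)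
  calc
    _ = (∑ k, h i k * ω k) * ∑ j, g i j * ∑ k, h j k * ω k := by
      rw [Finset.mul_sum]
      exact Finset.sum_congr rfl fun j _ => by ring
    _ = _ := by
      rw [lower i, Finset.sum_mul]
      exact Finset.sum_congr rfl fun j _ => by ring

/-- the polarization condition `V^{(2,2)} = 0` for the second-harmonic
corrector `F^{(2,2)}` on the initial hypersurface:
`Pol_𝐠(F^{(2,2)}, ℓ) + (3/4) F² ℓ = 0`. -/
theorem statement10
    (g h : Fin 3 → Fin 3 → ℝ)
    (hg_symm : ∀ i j, g i j = g j i)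
    (hg_pos : ∀ ξ : Fin 3 → ℝ, ξ ≠ 0 → 0 < ∑ i, ∑ j, g i j * ξ i * ξ j)
    (h_inv₁ : ∀ i j, (∑ k, g i k * h k j) = if i = j then (1 : ℝ) else 0)
    (h_inv₂ : ∀ i j, (∑ k, h i k * g k j) = if i = j then (1 : ℝ) else 0)
    (ω : Fin 3 → ℝ) (hω : ω ≠ 0)
    (F : ℝ)
    (Fb : Fin 3 → Fin 3 → ℝ)
    (hFb_symm : ∀ i j, Fb i j = Fb j i)
    (hFb_norm : (∑ i, ∑ k, ∑ j, ∑ l, h i k * h j l * Fb i j * Fb k l) = 8 * F ^ 2) :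
    ∀ α,
      (∑ μ, ∑ ν, blk (-1) (fun _ => 0) h μ ν
          * blk 0 (fun i => (3 / 8) * F ^ 2 * ω i / nrm3 h ω)
              (fun i j => (3 / 4) * F ^ 2 * g i j) α μ
          * cov4 (nrm3 h ω) ω ν)
      - (1 / 2) * (∑ μ, ∑ ν, blk (-1) (fun _ => 0) h μ ν
          * blk 0 (fun i => (3 / 8) * F ^ 2 * ω i / nrm3 h ω)
              (fun i j => (3 / 4) * F ^ 2 * g i j) μ ν)
          * cov4 (nrm3 h ω) ω α
      + (3 / 4) * F ^ 2 * cov4 (nrm3 h ω) ω α = 0 := by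
  have quad_pos := sum_inverse_mul_mul_pos hg_pos h_inv₁ hω
  have nrm_pos : 0 < nrm3 h ω := Real.sqrt_pos.mpr quad_pos
  have nrm_sq : nrm3 h ω ^ 2 = ∑ i, ∑ j, h i j * ω i * ω j := Real.sq_sqrt quad_pos.le
  have lower := sum_mul_sum_mul_of_inverse h_inv₁ ω
  have trace : ∑ i, ∑ j, h i j * g i j = 3 := by
    calc
      _ = ∑ i, ∑ j, h i j * g j i :=
        Finset.sum_congr rfl fun i _ => Finset.sum_congr rfl fun j _ => by rw [hg_symm]
      _ = 3 := by simp [h_inv₂]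
  generalize nrm3 h ω = n at nrm_pos nrm_sq ⊢
  have n_ne := nrm_pos.ne'
  have trace_blk : (∑ μ, ∑ ν, blk (-1) (fun _ => 0) h μ ν
      * blk 0 (fun i => (3 / 8) * F ^ 2 * ω i / n)
          (fun i j => (3 / 4) * F ^ 2 * g i j) μ ν) = 9 / 4 * F ^ 2 := by
    simp only [Fin.sum_univ_succ (n := 3), blk, Fin.succ_ne_zero, dite_true, dite_false,
      Fin.pred_succ, mul_zero, zero_mul, Finset.sum_const_zero, zero_add]
    calc
      _ = 3 / 4 * F ^ 2 * ∑ i, ∑ j, h i j * g i j := by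
        simp_rw [Finset.mul_sum]
        exact Finset.sum_congr rfl fun i _ => Finset.sum_congr rfl fun j _ => by ring
      _ = _ := by rw [trace]; ring
  intro α
  rw [trace_blk]
  refine Fin.cases ?_ (fun i => ?_) α
  · simp only [Fin.sum_univ_succ (n := 3), blk, cov4, Fin.succ_ne_zero, dite_true, dite_false,
      Fin.pred_succ, mul_zero, zero_mul, Finset.sum_const_zero, zero_add]
    have contraction : ∑ j, ∑ k, h j k * (3 / 8 * F ^ 2 * ω j / n) * ω k
        = 3 / 8 * F ^ 2 * n := by
      calc
        _ = 3 / 8 * F ^ 2 / n * ∑ j, ∑ k, h j k * ω j * ω k := by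
          simp_rw [Finset.mul_sum]
          exact Finset.sum_congr rfl fun i _ => Finset.sum_congr rfl fun j _ => by ring
        _ = _ := by rw [← nrm_sq]; field_simp
    rw [contraction]
    ring
  · simp only [Fin.sum_univ_succ (n := 3), blk, cov4, Fin.succ_ne_zero, dite_true, dite_false,
      Fin.pred_succ, zero_mul, Finset.sum_const_zero, zero_add, add_zero]
    have contraction : ∑ j, ∑ k, h j k * (3 / 4 * F ^ 2 * g i j) * ω k
        = 3 / 4 * F ^ 2 * ω i := by
      conv_rhs => rw [← lower i]
      simp_rw [Finset.mul_sum]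
      exact Finset.sum_congr rfl fun i _ => Finset.sum_congr rfl fun j _ => by ring
    rw [contraction]
    field_simp
    ring
end

section
/- Let U ⊆ ℝ³ be open, let g : U → positive definite symmetric 3×3 matrices be smooth with pointwise inverse h, let u : U → ℝ be smooth, and let F̄ : U → symmetric 3×3 matrices be smooth, such that identically on U: h^{ij} F̄_{ij} = 0 and F̄_{ij} h^{jk} ∂_k u = 0 for all i. Define Q̄^k_{ij} := (1/2)[ h^{kl}( ∂_i F̄_{jl} + ∂_j F̄_{il} − ∂_l F̄_{ij} ) − h^{ka} h^{lb} F̄_{ab} ( ∂_i g_{jl} + ∂_j g_{il} − ∂_l g_{ij} ) ]. Then identically on U: (a) Q̄^k_{kj} = 0 for every j; (b) h^{ij} ∂_k u · Q̄^k_{ij} = F̄_{ij} ( −h^{ia} ∂_a ( h^{jb} ∂_b u ) + (1/2) h^{lm} ∂_m u · ∂_l h^{ij} ). -/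
open BigOperators

noncomputable section

/-- The spatial slice `ℝ³`. -/
abbrev Spc : Type := Fin 3 → ℝ

/-- The partial derivative `∂_i f (x) := (fderiv ℝ f x)(e_i)`. -/
def pd (i : Fin 3) (f : Spc → ℝ) (x : Spc) : ℝ := fderiv ℝ f x (Pi.single i 1)

/-- The first-order Christoffel profile
`Q̄^k_{ij} := (1/2)[ h^{kl}( ∂_i F̄_{jl} + ∂_j F̄_{il} − ∂_l F̄_{ij} )
  − h^{ka} h^{lb} F̄_{ab} ( ∂_i g_{jl} + ∂_j g_{il} − ∂_l g_{ij} ) ]`. -/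
def Qbar (g h Fb : Fin 3 → Fin 3 → Spc → ℝ) (k i j : Fin 3) (x : Spc) : ℝ :=
  (1 / 2) *
    ( (∑ l, h k l x * (pd i (Fb j l) x + pd j (Fb i l) x - pd l (Fb i j) x))
    - (∑ l, ∑ a, ∑ b, h k a x * h l b x * Fb a b x
        * (pd i (g j l) x + pd j (g i l) x - pd l (g i j) x)) )

end

/-- A smooth function on an open set is differentiable at each of its points. -/
lemma differentiableAt_of_smoothOn {U : Set Spc} (hU : IsOpen U) {f : Spc → ℝ}
    (hf : ContDiffOn ℝ (⊤ : ℕ∞) f U) {x : Spc} (hx : x ∈ U) : DifferentiableAt ℝ f x :=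
  (hf.contDiffAt (hU.mem_nhds hx)).differentiableAt (by simp)

/-- The partial derivatives of a smooth function on an open set are differentiable. -/
lemma differentiableAt_pd {U : Set Spc} (hU : IsOpen U) {f : Spc → ℝ}
    (hf : ContDiffOn ℝ (⊤ : ℕ∞) f U) (i : Fin 3) {x : Spc} (hx : x ∈ U) :
    DifferentiableAt ℝ (pd i f) x := by
  have h : DifferentiableAt ℝ (fderiv ℝ f) x :=
    ((hf.contDiffAt (hU.mem_nhds hx)).fderiv_right (m := 1)
      (by norm_cast)).differentiableAt (by simp)
  exact h.clm_apply (differentiableAt_const _)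

lemma pd_congr {U : Set Spc} (hU : IsOpen U) {f f' : Spc → ℝ} (hff : ∀ x ∈ U, f x = f' x)
    (i : Fin 3) {x : Spc} (hx : x ∈ U) : pd i f x = pd i f' x := by
  have h : f =ᶠ[nhds x] f' := Filter.eventually_of_mem (hU.mem_nhds hx) hff
  rw [pd, pd, h.fderiv_eq]

lemma pd_eq_zero_of_const {U : Set Spc} (hU : IsOpen U) {f : Spc → ℝ} {c : ℝ}
    (hf : ∀ x ∈ U, f x = c) (i : Fin 3) {x : Spc} (hx : x ∈ U) : pd i f x = 0 := by
  rw [pd_congr hU (f' := fun _ => c) hf i hx]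
  simp [pd]

lemma pd_mul {f f' : Spc → ℝ} {x : Spc} (hf : DifferentiableAt ℝ f x)
    (hf' : DifferentiableAt ℝ f' x) (i : Fin 3) :
    pd i (fun y => f y * f' y) x = pd i f x * f' x + f x * pd i f' x := by
  simp only [pd, fderiv_fun_mul hf hf', add_apply,
    smul_apply, smul_eq_mul]
  ring

lemma pd_sum {f : Fin 3 → Spc → ℝ} {x : Spc} (hf : ∀ k, DifferentiableAt ℝ (f k) x)
    (i : Fin 3) : pd i (fun y => ∑ k, f k y) x = ∑ k, pd i (f k) x := by
  simp only [pd, fderiv_fun_sum fun k _ => hf k, sum_apply]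

lemma pd_sum_mul {f f' : Fin 3 → Spc → ℝ} {x : Spc} (hf : ∀ k, DifferentiableAt ℝ (f k) x)
    (hf' : ∀ k, DifferentiableAt ℝ (f' k) x) (i : Fin 3) :
    pd i (fun y => ∑ k, f k y * f' k y) x
      = ∑ k, (pd i (f k) x * f' k x + f k x * pd i (f' k) x) := by
  rw [pd_sum fun k => (hf k).fun_mul (hf' k)]
  simp only [pd_mul (hf _) (hf' _)]

/-- The double sum of an antisymmetric array vanishes. -/
lemma sum_sum_eq_zero_of_antisymm {ι : Type*} [Fintype ι] {T : ι → ι → ℝ}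
    (hT : ∀ k l, T k l = -T l k) : ∑ k, ∑ l, T k l = 0 := by
  have h : ∑ k, ∑ l, T k l = -∑ k, ∑ l, T k l := by
    conv_lhs => rw [Finset.sum_comm]
    simp only [← Finset.sum_neg_distrib]
    exact Finset.sum_congr rfl fun k _ => Finset.sum_congr rfl fun l _ => hT l k
  linarith

/-- A two-sided inverse of a symmetric matrix, given entrywise, is symmetric. -/
lemma inverse_entries_symm {ι : Type*} [Fintype ι] [DecidableEq ι] {g h : ι → ι → ℝ}
    (hg : ∀ i j, g i j = g j i)
    (hgh : ∀ i j, (∑ k, g i k * h k j) = if i = j then (1 : ℝ) else 0) (i j : ι) :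
    h i j = h j i := by
  have hmul : Matrix.of g * Matrix.of h = 1 := by
    ext i j
    simpa [Matrix.mul_apply, Matrix.one_apply] using hgh i j
  have hsymm : (Matrix.of g).IsSymm := by
    ext i j
    exact hg j i
  have hinv : (Matrix.of g)⁻¹ = Matrix.of h := Matrix.inv_eq_right_inv hmul
  have := hsymm.inv
  rw [hinv] at this
  exact this.apply j i

/-- From `∂h · g + h · ∂g = 0` and `g · h = 1` one gets `∂h = -h · ∂g · h`. -/
lemma deriv_inverse_entries {ι : Type*} [Fintype ι] [DecidableEq ι] {g h dg dh : ι → ι → ℝ}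
    (hgh : ∀ i j, (∑ k, g i k * h k j) = if i = j then (1 : ℝ) else 0)
    (hd : ∀ i j, ∑ k, (dh i k * g k j + h i k * dg k j) = 0) (i j : ι) :
    dh i j = -∑ k, ∑ l, h i k * dg k l * h l j := by
  have hmul : Matrix.of g * Matrix.of h = 1 := by
    ext i j
    simpa [Matrix.mul_apply, Matrix.one_apply] using hgh i j
  have hd' : Matrix.of dh * Matrix.of g = -(Matrix.of h * Matrix.of dg) := by
    refine eq_neg_of_add_eq_zero_left ?_
    ext i j
    simpa [Matrix.mul_apply, Finset.sum_add_distrib] using hd i j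
  have key : Matrix.of dh = -(Matrix.of h * Matrix.of dg * Matrix.of h) := by
    rw [← Matrix.neg_mul, ← hd', Matrix.mul_assoc, hmul, Matrix.mul_one]
  have := congrFun (congrFun key i) j
  simp only [Matrix.of_apply, Matrix.neg_apply, Matrix.mul_apply, Finset.sum_mul] at this
  rw [this, Finset.sum_comm]

/-- The trace `Γ^k_{kj}` of a Christoffel-type expression built from a symmetric `h`. -/
lemma sum_christoffel_trace {ι : Type*} [Fintype ι] {h : ι → ι → ℝ} {D : ι → ι → ι → ℝ}
    (hh : ∀ i j, h i j = h j i) (hD : ∀ m i j, D m i j = D m j i) (j : ι) :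
    ∑ k, ∑ l, h k l * (D k j l + D j k l - D l k j) = ∑ k, ∑ l, h k l * D j k l := by
  have h0 : ∑ k, ∑ l, h k l * (D k j l - D l k j) = 0 :=
    sum_sum_eq_zero_of_antisymm fun k l => by
      rw [hh k l, hD k j l, hD l k j]
      ring
  rw [← sub_eq_zero, ← h0]
  simp only [← Finset.sum_sub_distrib]
  exact Finset.sum_congr rfl fun k _ => Finset.sum_congr rfl fun l _ => by ring

/-- the Christoffel profile `Q̄` of a g-trace-free symmetric tensor `F̄`
transverse to `∇u` satisfies `Q̄^k_{kj} = 0` and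
`h^{ij} ∂_k u Q̄^k_{ij} = F̄_{ij}(−∂^i∂^j u + (1/2) ∂^ℓ u ∂_ℓ h^{ij})` on `U`. -/
theorem statement16
    (U : Set Spc) (hU : IsOpen U)
    (g h Fb : Fin 3 → Fin 3 → Spc → ℝ) (u : Spc → ℝ)
    (hg_smooth : ∀ i j, ContDiffOn ℝ (⊤ : ℕ∞) (g i j) U)
    (hh_smooth : ∀ i j, ContDiffOn ℝ (⊤ : ℕ∞) (h i j) U)
    (hF_smooth : ∀ i j, ContDiffOn ℝ (⊤ : ℕ∞) (Fb i j) U)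
    (hu_smooth : ContDiffOn ℝ (⊤ : ℕ∞) u U)
    (hg_symm : ∀ x ∈ U, ∀ i j, g i j x = g j i x)
    (hg_pos : ∀ x ∈ U, ∀ ξ : Fin 3 → ℝ, ξ ≠ 0 → 0 < ∑ i, ∑ j, g i j x * ξ i * ξ j)
    (hF_symm : ∀ x ∈ U, ∀ i j, Fb i j x = Fb j i x)
    (h_inv₁ : ∀ x ∈ U, ∀ i j, (∑ k, g i k x * h k j x) = if i = j then (1 : ℝ) else 0)
    (h_inv₂ : ∀ x ∈ U, ∀ i j, (∑ k, h i k x * g k j x) = if i = j then (1 : ℝ) else 0)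
    (hF_tr : ∀ x ∈ U, (∑ i, ∑ j, h i j x * Fb i j x) = 0)
    (hF_trans : ∀ x ∈ U, ∀ i, (∑ j, ∑ k, Fb i j x * h j k x * pd k u x) = 0) :
    (∀ x ∈ U, ∀ j, (∑ k, Qbar g h Fb k k j x) = 0)
    ∧ (∀ x ∈ U,
        (∑ i, ∑ j, ∑ k, h i j x * pd k u x * Qbar g h Fb k i j x)
        = ∑ i, ∑ j, Fb i j x *
            ( -(∑ a, h i a x * pd a (fun y => ∑ b, h j b y * pd b u y) x)
              + (1 / 2) * (∑ l, ∑ m, h l m x * pd m u x * pd l (h i j) x) )) := by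
  have dg : ∀ x ∈ U, ∀ i j, DifferentiableAt ℝ (g i j) x := fun x hx i j =>
    differentiableAt_of_smoothOn hU (hg_smooth i j) hx
  have dh : ∀ x ∈ U, ∀ i j, DifferentiableAt ℝ (h i j) x := fun x hx i j =>
    differentiableAt_of_smoothOn hU (hh_smooth i j) hx
  have dF : ∀ x ∈ U, ∀ i j, DifferentiableAt ℝ (Fb i j) x := fun x hx i j =>
    differentiableAt_of_smoothOn hU (hF_smooth i j) hx
  have dgrad : ∀ x ∈ U, ∀ j, DifferentiableAt ℝ (fun y => ∑ b, h j b y * pd b u y) x :=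
    fun x hx j => DifferentiableAt.fun_sum fun b _ =>
      (dh x hx j b).fun_mul (differentiableAt_pd hU hu_smooth b hx)
  have h_symm : ∀ x ∈ U, ∀ i j, h i j x = h j i x := fun x hx =>
    inverse_entries_symm (g := fun i j => g i j x) (h := fun i j => h i j x)
      (hg_symm x hx) (h_inv₁ x hx)
  have pg_symm : ∀ x ∈ U, ∀ m i j, pd m (g i j) x = pd m (g j i) x := fun x hx m i j =>
    pd_congr hU (fun y hy => hg_symm y hy i j) m hx
  have pF_symm : ∀ x ∈ U, ∀ m i j, pd m (Fb i j) x = pd m (Fb j i) x := fun x hx m i j =>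
    pd_congr hU (fun y hy => hF_symm y hy i j) m hx
  have ph : ∀ x ∈ U, ∀ m i j,
      pd m (h i j) x = -∑ k, ∑ l, h i k x * pd m (g k l) x * h l j x := fun x hx m =>
    deriv_inverse_entries (g := fun i j => g i j x) (h := fun i j => h i j x)
      (dg := fun i j => pd m (g i j) x) (dh := fun i j => pd m (h i j) x) (h_inv₁ x hx)
      fun i j => by
        rw [← pd_sum_mul (fun k => dh x hx i k) (fun k => dg x hx k j)]
        exact pd_eq_zero_of_const hU (fun y hy => h_inv₂ y hy i j) m hx
  have ptr : ∀ x ∈ U, ∀ m,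
      ∑ i, ∑ j, (pd m (h i j) x * Fb i j x + h i j x * pd m (Fb i j) x) = 0 := by
    intro x hx m
    rw [← pd_eq_zero_of_const hU hF_tr m hx,
      pd_sum fun i => DifferentiableAt.fun_sum fun j _ => (dh x hx i j).fun_mul (dF x hx i j)]
    exact Finset.sum_congr rfl fun i _ => (pd_sum_mul (dh x hx i) (dF x hx i) m).symm
  have transv : ∀ x ∈ U, ∀ i, ∑ j, Fb i j x * ∑ k, h j k x * pd k u x = 0 := by
    intro x hx i
    simpa only [Finset.mul_sum, mul_assoc] using hF_trans x hx i
  have ptransv : ∀ x ∈ U, ∀ m i, ∑ j, (pd m (Fb i j) x * (∑ k, h j k x * pd k u x)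
      + Fb i j x * pd m (fun y => ∑ b, h j b y * pd b u y) x) = 0 := by
    intro x hx m i
    rw [← pd_eq_zero_of_const hU (fun y hy => transv y hy i) m hx,
      pd_sum_mul (dF x hx i) (dgrad x hx) m]
  refine ⟨fun x hx j => ?_, fun x hx => ?_⟩
  · have h1 := sum_christoffel_trace (h := fun k l => h k l x)
      (D := fun m i j => pd m (Fb i j) x) (h_symm x hx) (pF_symm x hx) j
    have h2 := sum_christoffel_trace (h := fun k l => ∑ a, ∑ b, h k a x * h l b x * Fb a b x)
      (D := fun m i j => pd m (g i j) x) (fun k l => by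
        rw [Finset.sum_comm]
        exact Finset.sum_congr rfl fun a _ => Finset.sum_congr rfl fun b _ => by
          rw [hF_symm x hx b a]
          ring) (pg_symm x hx) j
    have h3 : ∑ k, ∑ l, (∑ a, ∑ b, h k a x * h l b x * Fb a b x) * pd j (g k l) x
        = -∑ a, ∑ b, pd j (h a b) x * Fb a b x := by
      simp only [ph x hx, neg_mul, Finset.sum_neg_distrib, neg_neg, Finset.sum_mul]
      simp only [← Fintype.sum_prod_type']
      refine Fintype.sum_equiv
        ⟨fun p => (p.2.2.1, p.2.2.2, p.1, p.2.1), fun p => (p.2.2.1, p.2.2.2, p.1, p.2.1),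
          fun _ => rfl, fun _ => rfl⟩ _ _ fun p => ?_
      simp only [Equiv.coe_fn_mk]
      rw [h_symm x hx p.1]
      ring
    have h4 := ptr x hx j
    simp only [Finset.sum_add_distrib] at h4
    simp only [Qbar, ← Finset.mul_sum, Finset.sum_sub_distrib, ← Finset.sum_mul]
    rw [h1, h2, h3]
    linarith
  · set v : Fin 3 → Spc → ℝ := fun j y => ∑ b, h j b y * pd b u y with hv
    have hFv : ∀ b, ∑ a, Fb a b x * v a x = 0 := fun b => by
      rw [← transv x hx b]
      exact Finset.sum_congr rfl fun a _ => by rw [hF_symm x hx a b]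
    have hlow : ∀ X : Fin 3 → ℝ, ∑ k, pd k u x * ∑ l, h k l x * X l = ∑ l, v l x * X l := by
      intro X
      simp only [hv, Finset.mul_sum, Finset.sum_mul]
      rw [Finset.sum_comm]
      exact Finset.sum_congr rfl fun l _ => Finset.sum_congr rfl fun k _ => by
        rw [h_symm x hx k l]
        ring
    have hup : ∀ Y : Fin 3 → ℝ,
        ∑ k, pd k u x * ∑ l, ∑ a, ∑ b, h k a x * h l b x * Fb a b x * Y l = 0 := by
      intro Y
      have h1 : ∀ k, ∑ l, ∑ a, ∑ b, h k a x * h l b x * Fb a b x * Y l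
          = ∑ a, h k a x * ∑ l, ∑ b, h l b x * Fb a b x * Y l := fun k => by
        rw [Finset.sum_comm]
        simp only [Finset.mul_sum, mul_assoc]
      have h2 : ∑ a, v a x * ∑ l, ∑ b, h l b x * Fb a b x * Y l
          = ∑ l, ∑ b, h l b x * Y l * ∑ a, Fb a b x * v a x := by
        simp only [Finset.mul_sum]
        rw [Finset.sum_comm]
        refine Finset.sum_congr rfl fun l _ => ?_
        rw [Finset.sum_comm]
        exact Finset.sum_congr rfl fun b _ => Finset.sum_congr rfl fun a _ => by ring
      simp only [h1, hlow, h2, hFv, mul_zero, Finset.sum_const_zero]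
    have hQ : ∀ i j, ∑ k, pd k u x * Qbar g h Fb k i j x = (1 / 2) *
        ∑ l, v l x * (pd i (Fb j l) x + pd j (Fb i l) x - pd l (Fb i j) x) := fun i j => by
      rw [← hlow]
      refine eq_of_sub_eq_zero (Eq.trans ?_ (mul_eq_zero_of_right (-(1 / 2))
        (hup fun l => pd i (g j l) x + pd j (g i l) x - pd l (g i j) x)))
      rw [Finset.mul_sum, Finset.mul_sum, ← Finset.sum_sub_distrib]
      exact Finset.sum_congr rfl fun k _ => by
        rw [Qbar]
        ring
    have hdiv : ∀ i j, ∑ l, v l x * pd i (Fb j l) x = -∑ l, Fb j l x * pd i (v l) x :=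
      fun i j => by
        rw [eq_neg_iff_add_eq_zero, ← ptransv x hx i j, ← Finset.sum_add_distrib]
        exact Finset.sum_congr rfl fun l _ => by ring
    have hsplit : ∀ i j,
        ∑ l, v l x * (pd i (Fb j l) x + pd j (Fb i l) x - pd l (Fb i j) x)
          = -∑ l, Fb j l x * pd i (v l) x - ∑ l, Fb i l x * pd j (v l) x
            - ∑ l, v l x * pd l (Fb i j) x := fun i j => by
      simp only [mul_sub, mul_add, Finset.sum_sub_distrib, Finset.sum_add_distrib, hdiv]
      ring
    have hflux : ∑ i, ∑ j, h i j x * ∑ l, Fb j l x * pd i (v l) x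
        = ∑ i, ∑ j, Fb i j x * ∑ a, h i a x * pd a (v j) x := by
      simp only [Finset.mul_sum]
      rw [Finset.sum_comm]
      refine Finset.sum_congr rfl fun j _ => ?_
      rw [Finset.sum_comm]
      exact Finset.sum_congr rfl fun l _ => Finset.sum_congr rfl fun i _ => by
        rw [h_symm x hx i j]
        ring
    have hflux' : ∑ i, ∑ j, h i j x * ∑ l, Fb i l x * pd j (v l) x
        = ∑ i, ∑ j, Fb i j x * ∑ a, h i a x * pd a (v j) x := by
      rw [← hflux, Finset.sum_comm]
      exact Finset.sum_congr rfl fun j _ => Finset.sum_congr rfl fun i _ => by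
        rw [h_symm x hx i j]
    have htr : ∑ i, ∑ j, h i j x * ∑ l, v l x * pd l (Fb i j) x
        = -∑ i, ∑ j, Fb i j x * ∑ l, v l x * pd l (h i j) x := by
      have h1 : ∑ l, v l x *
          ∑ i, ∑ j, (pd l (h i j) x * Fb i j x + h i j x * pd l (Fb i j) x) = 0 := by
        simp only [ptr x hx, mul_zero, Finset.sum_const_zero]
      rw [eq_neg_iff_add_eq_zero, ← h1]
      simp only [Finset.mul_sum, ← Finset.sum_add_distrib]
      conv_rhs => rw [Finset.sum_comm]
      refine Finset.sum_congr rfl fun i _ => ?_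
      conv_rhs => rw [Finset.sum_comm]
      exact Finset.sum_congr rfl fun j _ => Finset.sum_congr rfl fun l _ => by ring
    have hgrad : ∀ i j, ∑ l, ∑ m, h l m x * pd m u x * pd l (h i j) x
        = ∑ l, v l x * pd l (h i j) x := fun i j => by
      simp only [hv, Finset.sum_mul]
    have hL : ∀ i j, ∑ k, h i j x * pd k u x * Qbar g h Fb k i j x
        = (1 / 2) * (-(h i j x * ∑ l, Fb j l x * pd i (v l) x)
          - h i j x * ∑ l, Fb i l x * pd j (v l) x
          - h i j x * ∑ l, v l x * pd l (Fb i j) x) := fun i j => by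
      simp only [mul_assoc, ← Finset.mul_sum]
      rw [hQ, hsplit]
      ring
    simp only [hL, hgrad, mul_add, mul_neg, mul_left_comm _ (1 / 2 : ℝ), ← Finset.mul_sum,
      Finset.sum_sub_distrib, Finset.sum_add_distrib, Finset.sum_neg_distrib]
    rw [hflux, hflux', htr]
    ring
end
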